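/- arXiv:1601.00479 — 2 statements merged into one kernel-verified Lean document; each statement's English description precedes it below -/
import Mathlib

section
/- Let G be a task graph with n vertices, let β ∈ (0,1) be a bias factor and let r ≥ 0 be a reward. If G has a motivating subgraph for reward r and bias β, then there exists a directed path from s to t in G such that the subgraph of G consisting of exactly the edges of this path is motivating for reward (1 + √n)·r and bias β. -/
open scoped ENNReal

/-- A task graph: a finite directed acyclic graph with nonnegative real edge
costs, a source `s` and a target `t`. -/
structure TaskGraph (V : Type) [Fintype V] where
  E : V → V → Prop
  cost : V → V → ℝ
  s : V
  t : V
  cost_nonneg : ∀ v w, 0 ≤ cost v w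
  acyclic : ∀ (v : V) (l : List V),
    l.Chain' E → l.head? = some v → l.getLast? = some v → l.length ≤ 1

namespace TaskGraph

variable {V : Type} [Fintype V]

/-- `l` is the list of vertices of a directed path from `u` to `v` in `G`. -/
def IsPathFrom (G : TaskGraph V) (u v : V) (l : List V) : Prop :=
  l ≠ [] ∧ l.head? = some u ∧ l.getLast? = some v ∧ l.Chain' G.E

/-- Total edge cost of a path, given as the list of its vertices. -/
def pathCost (G : TaskGraph V) (l : List V) : ℝ :=
  (List.zipWith G.cost l l.tail).sum

/-- `d_G(v)`: minimum total edge cost of a directed path from `v` to `t`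
(`∞` if no such path exists). -/
noncomputable def dist (G : TaskGraph V) (v : V) : ℝ≥0∞ :=
  sInf {x | ∃ l, G.IsPathFrom v G.t l ∧ x = ENNReal.ofReal (G.pathCost l)}

/-- `ζ_G(v)`: the agent's lowest perceived cost at `v` for bias factor `β`
(`∞` if `v` has no outgoing edge). -/
noncomputable def zeta (G : TaskGraph V) (β : ℝ) (v : V) : ℝ≥0∞ :=
  sInf {x | ∃ w, G.E v w ∧
    x = ENNReal.ofReal (G.cost v w) + ENNReal.ofReal β * G.dist w}

/-- One step of the agent for reward `r` placed at `t` and bias `β`. -/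
def step (G : TaskGraph V) (β r : ℝ) (v w : V) : Prop :=
  v ≠ G.t ∧ G.zeta β v ≤ ENNReal.ofReal (β * r) ∧ G.E v w ∧
    ENNReal.ofReal (G.cost v w) + ENNReal.ofReal β * G.dist w = G.zeta β v

/-- An agent walk: a maximal sequence of steps starting at `s`.  The walk stops
at its last vertex `v` only if `v = t`, or `ζ_G(v) > β·r` (which includes the
case that `v` has no outgoing edge, where `ζ_G(v) = ∞`). -/
def AgentWalk (G : TaskGraph V) (β r : ℝ) (l : List V) : Prop :=
  l.head? = some G.s ∧ l.Chain' (G.step β r) ∧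
    ∀ v, l.getLast? = some v →
      v = G.t ∨ ¬ G.zeta β v ≤ ENNReal.ofReal (β * r)

/-- `G` is motivating for reward `r` and bias `β` if every agent walk ends at `t`. -/
def Motivating (G : TaskGraph V) (β r : ℝ) : Prop :=
  ∀ l, G.AgentWalk β r l → l.getLast? = some G.t

/-- `G'` is a subgraph of `G`: same vertices, source, target and costs, and a
subset of the edges. -/
def Subgraph (G' G : TaskGraph V) : Prop :=
  G'.s = G.s ∧ G'.t = G.t ∧ G'.cost = G.cost ∧ ∀ v w, G'.E v w → G.E v w

/-- `(v, w)` is an edge of the path with vertex list `l`. -/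
def edgeOfPath (l : List V) (v w : V) : Prop :=
  (v, w) ∈ List.zip l l.tail

/-- `G'` is the subgraph of `G` consisting of exactly the edges of the path `l`. -/
def IsPathSubgraph (G' G : TaskGraph V) (l : List V) : Prop :=
  G'.s = G.s ∧ G'.t = G.t ∧ G'.cost = G.cost ∧
    ∀ v w, G'.E v w ↔ edgeOfPath l v w

end TaskGraph

namespace TaskGraph

variable {V : Type} [Fintype V]

theorem nodup_of_isChain (G : TaskGraph V) {l : List V} (h : l.IsChain G.E) : l.Nodup := by
  induction l with
  | nil => exact List.nodup_nil
  | cons v l ih =>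
    refine List.nodup_cons.2 ⟨fun hv => ?_, ih h.tail⟩
    obtain ⟨a, b, rfl⟩ := List.append_of_mem hv
    have hc : (v :: a ++ [v]).IsChain G.E := h.prefix ⟨b, by simp⟩
    have := G.acyclic v _ hc rfl (by rw [List.getLast?_append]; rfl)
    simp at this

theorem length_le_card_of_isChain (G : TaskGraph V) {l : List V} (h : l.IsChain G.E) :
    l.length ≤ Fintype.card V :=
  (G.nodup_of_isChain h).length_le_card

theorem exists_zeta_eq (G : TaskGraph V) {β : ℝ} {v : V} (h : G.zeta β v ≠ ⊤) :
    ∃ w, G.E v w ∧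
      G.zeta β v = ENNReal.ofReal (G.cost v w) + ENNReal.ofReal β * G.dist w := by
  have hfin : {x | ∃ w, G.E v w ∧
      x = ENNReal.ofReal (G.cost v w) + ENNReal.ofReal β * G.dist w}.Finite := by
    refine (Set.finite_range
      fun w => ENNReal.ofReal (G.cost v w) + ENNReal.ofReal β * G.dist w).subset ?_
    rintro x ⟨w, -, rfl⟩
    exact ⟨w, rfl⟩
  refine Set.Nonempty.csInf_mem (Set.nonempty_iff_ne_empty.2 fun he => h ?_) hfin
  rw [zeta, he, sInf_empty]

theorem exists_dist_eq (G : TaskGraph V) {v : V} (h : G.dist v ≠ ⊤) :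
    ∃ l, G.IsPathFrom v G.t l ∧ G.dist v = ENNReal.ofReal (G.pathCost l) := by
  have hfin : {x | ∃ l, G.IsPathFrom v G.t l ∧ x = ENNReal.ofReal (G.pathCost l)}.Finite := by
    refine ((List.finite_length_le V (Fintype.card V)).image
      fun l => ENNReal.ofReal (G.pathCost l)).subset ?_
    rintro x ⟨l, hl, rfl⟩
    exact ⟨l, G.length_le_card_of_isChain hl.2.2.2, rfl⟩
  refine Set.Nonempty.csInf_mem (Set.nonempty_iff_ne_empty.2 fun he => h ?_) hfin
  rw [dist, he, sInf_empty]

theorem pathCost_cons_cons (G : TaskGraph V) (v w : V) (l : List V) :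
    G.pathCost (v :: w :: l) = G.cost v w + G.pathCost (w :: l) := by
  simp [pathCost]

theorem pathCost_nonneg (G : TaskGraph V) (l : List V) : 0 ≤ G.pathCost l := by
  induction l with
  | nil => simp [pathCost]
  | cons v l ih =>
    cases l with
    | nil => simp [pathCost]
    | cons w l =>
      rw [pathCost_cons_cons]
      exact add_nonneg (G.cost_nonneg v w) ih

theorem pathCost_le_append (G : TaskGraph V) (a l : List V) :
    G.pathCost l ≤ G.pathCost (a ++ l) := by
  induction a with
  | nil => rfl
  | cons v a ih =>
    refine ih.trans ?_
    rw [List.cons_append]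
    cases a ++ l with
    | nil => exact G.pathCost_nonneg _
    | cons w m =>
      rw [pathCost_cons_cons]
      exact le_add_of_nonneg_left (G.cost_nonneg v w)

theorem pathCost_le_length_mul (G : TaskGraph V) {C : ℝ} (hC : 0 ≤ C) {l : List V}
    (h : l.IsChain fun v w => G.cost v w ≤ C) : G.pathCost l ≤ l.length * C := by
  induction l with
  | nil => simp [pathCost]
  | cons v l ih =>
    cases l with
    | nil => simpa [pathCost] using hC
    | cons w l =>
      rw [pathCost_cons_cons, List.length_cons, Nat.cast_succ, add_mul, one_mul, add_comm]
      exact add_le_add (ih h.tail) (List.isChain_cons_cons.1 h).1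

theorem exists_agentWalk (G : TaskGraph V) (β r : ℝ) : ∃ l, G.AgentWalk β r l := by
  suffices H : ∀ k (l : List V), l.head? = some G.s → l.IsChain (G.step β r) →
      Fintype.card V < l.length + k → ∃ l, G.AgentWalk β r l from
    H (Fintype.card V) [G.s] rfl (List.isChain_singleton _) (by simp)
  intro k
  induction k with
  | zero =>
    intro l _ hl hk
    have := G.length_le_card_of_isChain (hl.imp fun _ _ h => h.2.2.1)
    omega
  | succ k ih =>
    intro l hs hl hk
    by_cases hfinal : ∀ v, l.getLast? = some v →
        v = G.t ∨ ¬ G.zeta β v ≤ ENNReal.ofReal (β * r)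
    · exact ⟨l, hs, hl, hfinal⟩
    push Not at hfinal
    obtain ⟨v, hv, hvt, hz⟩ := hfinal
    obtain ⟨w, hw, hzw⟩ := G.exists_zeta_eq (ne_top_of_le_ne_top ENNReal.ofReal_ne_top hz)
    refine ih (l ++ [w]) (by simp [hs]) ?_ (by simp; omega)
    refine List.isChain_append.2 ⟨hl, List.isChain_singleton _, fun x hx y hy => ?_⟩
    obtain rfl : v = x := by simpa [hv] using hx
    obtain rfl : w = y := by simpa using hy
    exact ⟨hvt, hz, hw, hzw.symm⟩

theorem edgeOfPath_append {α : Type} (a : List α) (v w : α) (b : List α) :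
    edgeOfPath (a ++ v :: w :: b) v w := by
  induction a with
  | nil => simp [edgeOfPath]
  | cons x a ih =>
    unfold edgeOfPath at ih ⊢
    cases a <;> simp_all

theorem isChain_edgeOfPath {α : Type} (l : List α) : l.IsChain (edgeOfPath l) := by
  rw [List.isChain_iff_forall_rel_of_append_cons_cons]
  rintro v w a b rfl
  exact edgeOfPath_append a v w b

theorem Motivating.of_isPathSubgraph {G G' : TaskGraph V} {β R : ℝ} {l : List V}
    (hl : G.IsPathFrom G.s G.t l) (hG' : G'.IsPathSubgraph G l)
    (hβ : 0 ≤ β)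
    (h : ∀ a v w b, l = a ++ v :: w :: b →
      G.cost v w + β * G.pathCost (w :: b) ≤ β * R) :
    G'.Motivating β R := by
  obtain ⟨hs, ht, hc, hE⟩ := hG'
  obtain ⟨hne, hls, hlt, -⟩ := hl
  rintro m ⟨hms, hm, hfinal⟩
  have hml : ∀ x ∈ m, x ∈ l := by
    refine List.IsChain.induction _ _ hm ?_ ?_
    · rintro x y hxy -
      have := (hE x y).1 hxy.2.2.1
      exact List.mem_of_mem_tail (List.of_mem_zip this).2
    · intro hm0
      have : m.head hm0 = G.s := by
        rw [List.head?_eq_some_head hm0, hs] at hms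
        exact Option.some_inj.1 hms
      rw [this]
      exact List.mem_of_mem_head? (by simp [hls])
  have hm0 : m ≠ [] := by rintro rfl; simp at hms
  have hlast := List.getLast?_eq_some_getLast hm0
  set v := m.getLast hm0 with hv
  rcases hfinal v hlast with hvt | hz
  · rw [hlast, hvt]
  obtain ⟨a, b, hab⟩ := List.append_of_mem (hml v (List.getLast_mem hm0))
  cases b with
  | nil =>
    rw [hlast, ht, ← hlt, hab]
    simp
  | cons w b =>
    refine absurd ?_ hz
    have hpath : G'.IsPathFrom w G'.t (w :: b) := by
      refine ⟨List.cons_ne_nil _ _, rfl, ?_, ?_⟩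
      · rw [ht, ← hlt, hab, List.getLast?_append_of_ne_nil _ (List.cons_ne_nil _ _),
          List.getLast?_cons_cons]
      · have h1 : l.IsChain G'.E := (isChain_edgeOfPath l).imp fun x y => (hE x y).2
        exact h1.suffix ⟨a ++ [v], by simp [hab]⟩
    have hvw : G'.E v w := (hE v w).2 (hab ▸ edgeOfPath_append a v w b)
    have hd : G'.dist w ≤ ENNReal.ofReal (G'.pathCost (w :: b)) :=
      sInf_le ⟨_, hpath, rfl⟩
    have hpc : G'.pathCost (w :: b) = G.pathCost (w :: b) := by simp [pathCost, hc]
    calc G'.zeta β v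
        ≤ ENNReal.ofReal (G'.cost v w) + ENNReal.ofReal β * G'.dist w := sInf_le ⟨w, hvw, rfl⟩
      _ ≤ ENNReal.ofReal (G.cost v w) +
            ENNReal.ofReal β * ENNReal.ofReal (G.pathCost (w :: b)) := by
          rw [hpc] at hd
          rw [hc]
          gcongr
      _ = ENNReal.ofReal (G.cost v w + β * G.pathCost (w :: b)) := by
          rw [← ENNReal.ofReal_mul hβ, ENNReal.ofReal_add (G.cost_nonneg v w)
            (mul_nonneg hβ (G.pathCost_nonneg _))]
      _ ≤ ENNReal.ofReal (β * R) := ENNReal.ofReal_le_ofReal (h a v w b hab)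

/-- If the agent does not abandon at `v`, there is a path from `v` to `t` of cost at most `r`. -/
theorem exists_isPathFrom_pathCost_le (G : TaskGraph V) {β r : ℝ} {v : V}
    (hβ0 : 0 < β) (hβ1 : β ≤ 1) (hr : 0 ≤ r) (h : G.zeta β v ≤ ENNReal.ofReal (β * r)) :
    ∃ l, G.IsPathFrom v G.t l ∧ G.pathCost l ≤ r := by
  obtain ⟨w, hvw, hw⟩ := G.exists_zeta_eq (ne_top_of_le_ne_top ENNReal.ofReal_ne_top h)
  rw [hw] at h
  have hd : G.dist w ≠ ⊤ := by
    intro hd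
    rw [hd, ENNReal.mul_top (by simpa using hβ0), add_top] at h
    exact absurd h (by simp)
  obtain ⟨l, ⟨hne, hh, ht, hl⟩, hdl⟩ := G.exists_dist_eq hd
  obtain ⟨x, b, rfl⟩ := List.exists_cons_of_ne_nil hne
  obtain rfl : x = w := by simpa using hh
  refine ⟨v :: x :: b, ⟨List.cons_ne_nil _ _, rfl, by simpa using ht,
    List.isChain_cons_cons.2 ⟨hvw, hl⟩⟩, ?_⟩
  have hp := G.pathCost_nonneg (x :: b)
  have hc := G.cost_nonneg v x
  rw [hdl, ← ENNReal.ofReal_mul hβ0.le, ← ENNReal.ofReal_add hc (by positivity),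
    ENNReal.ofReal_le_ofReal_iff (by positivity)] at h
  rw [pathCost_cons_cons]
  refine le_of_mul_le_mul_left ?_ hβ0
  nlinarith

theorem step.cost_le {G : TaskGraph V} {β r : ℝ} {v w : V} (hβr : 0 ≤ β * r)
    (h : G.step β r v w) : G.cost v w ≤ β * r := by
  rw [← ENNReal.ofReal_le_ofReal_iff hβr]
  exact le_self_add.trans (h.2.2.2.le.trans h.2.1)

end TaskGraph

/-- If a task graph `G` with `n` vertices has a motivating
subgraph for reward `r ≥ 0` and bias `β ∈ (0,1)`, then there is a directed
path from `s` to `t` in `G` such that the subgraph of `G` consisting of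
exactly the edges of this path is motivating for reward `(1 + √n)·r`. -/
theorem motivating_path_subgraph_sqrt {V : Type} [Fintype V]
    (G : TaskGraph V) (β r : ℝ) (hβ0 : 0 < β) (hβ1 : β < 1) (hr : 0 ≤ r)
    (hmot : ∃ G' : TaskGraph V, G'.Subgraph G ∧ G'.Motivating β r) :
    ∃ l : List V, G.IsPathFrom G.s G.t l ∧
      ∀ G' : TaskGraph V, G'.IsPathSubgraph G l →
        G'.Motivating β ((1 + Real.sqrt (Fintype.card V)) * r) := by
  obtain ⟨H, ⟨hs, ht, hc, hE⟩, hH⟩ := hmot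
  set n : ℝ := (Fintype.card V : ℝ) with hn
  have hsq : √n * √n = n := Real.mul_self_sqrt (by positivity)
  obtain ⟨l, hl⟩ := H.exists_agentWalk β r
  have hlt := hH l hl
  obtain ⟨hls, hlc, -⟩ := hl
  have hl0 : l ≠ [] := by rintro rfl; simp at hls
  have hpath : G.IsPathFrom G.s G.t l :=
    ⟨hl0, hs ▸ hls, ht ▸ hlt, hlc.imp fun _ _ h => hE _ _ h.2.2.1⟩
  have hβr : 0 ≤ β * r := by positivity
  rcases le_total (β * √n) 1 with hβn | hβn
  · refine ⟨l, hpath, fun G' hG' => .of_isPathSubgraph hpath hG' hβ0.le ?_⟩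
    rintro a v w b rfl
    have hcost : (a ++ v :: w :: b).IsChain fun x y => G.cost x y ≤ β * r :=
      hlc.imp fun x y h => hc ▸ h.cost_le hβr
    have hvw := hcost.suffix (List.suffix_append a _)
    have hle := G.pathCost_le_length_mul hβr (List.isChain_cons_cons.1 hvw).2
    have hlen : ((w :: b).length : ℝ) ≤ n := by
      rw [hn]
      exact_mod_cast G.length_le_card_of_isChain
        (hpath.2.2.2.suffix ⟨a ++ [v], by simp⟩)
    have hnβ : n * β ≤ √n := by
      nlinarith [Real.sqrt_nonneg n]
    calc G.cost v w + β * G.pathCost (w :: b)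
        ≤ β * r + β * (n * (β * r)) := by
          gcongr
          · exact (List.isChain_cons_cons.1 hvw).1
          · exact hle.trans (by gcongr)
      _ = β * r + n * β * (β * r) := by ring
      _ ≤ β * r + √n * (β * r) := by gcongr
      _ = β * ((1 + √n) * r) := by ring
  · obtain ⟨p, hp, hpr⟩ : ∃ p, G.IsPathFrom G.s G.t p ∧ G.pathCost p ≤ r := by
      obtain ⟨x, m, rfl⟩ := List.exists_cons_of_ne_nil hl0
      obtain rfl : x = H.s := by simpa using hls
      cases m with
      | nil => exact ⟨_, hpath, by simpa [TaskGraph.pathCost] using hr⟩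
      | cons y m =>
        obtain ⟨p, ⟨hp0, hps, hpt, hpc⟩, hpr⟩ := H.exists_isPathFrom_pathCost_le hβ0 hβ1.le hr
          (List.isChain_cons_cons.1 hlc).1.2.1
        refine ⟨p, ⟨hp0, hs ▸ hps, ht ▸ hpt, hpc.imp fun _ _ h => hE _ _ h⟩, ?_⟩
        simpa [TaskGraph.pathCost, hc] using hpr
    refine ⟨p, hp, fun G' hG' => .of_isPathSubgraph hp hG' hβ0.le ?_⟩
    rintro a v w b rfl
    have hle := G.pathCost_le_append a (v :: w :: b)
    rw [G.pathCost_cons_cons] at hle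
    have := G.pathCost_nonneg (w :: b)
    calc G.cost v w + β * G.pathCost (w :: b)
        ≤ G.cost v w + G.pathCost (w :: b) := by
          gcongr
          exact mul_le_of_le_one_left this hβ1.le
      _ ≤ 1 * r := by linarith
      _ ≤ β * √n * r := by gcongr
      _ ≤ β * ((1 + √n) * r) := by nlinarith
end

section
/- Let G be a task graph, let β ∈ (0,1] and r ≥ 0. If some subgraph of G is motivating for reward r and bias β, then r ≥ d_G(s), where d_G(s) is the minimum total edge cost of a directed path from s to t in G. -/
open scoped ENNReal

namespace TaskGraph

variable {V : Type} [Fintype V]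

/-- Deleting edges can only increase the distance to the target. -/
theorem Subgraph.dist_le {G' G : TaskGraph V} (h : G'.Subgraph G) (v : V) :
    G.dist v ≤ G'.dist v := by
  obtain ⟨-, ht, hc, hE⟩ := h
  refine sInf_le_sInf ?_
  rintro x ⟨l, ⟨hne, hhead, hlast, hchain⟩, rfl⟩
  exact ⟨l, ⟨hne, hhead, ht ▸ hlast, hchain.imp hE⟩, by simp [pathCost, hc]⟩

theorem dist_target (G : TaskGraph V) : G.dist G.t = 0 := by
  refine le_antisymm (sInf_le ⟨[G.t], ⟨by simp, by simp, by simp, ?_⟩, by simp [pathCost]⟩) bot_le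
  exact List.isChain_singleton _

theorem dist_le_cost_add_dist (G : TaskGraph V) {v w : V} (h : G.E v w) :
    G.dist v ≤ ENNReal.ofReal (G.cost v w) + G.dist w := by
  conv_rhs => rw [dist, ENNReal.add_sInf]
  refine le_iInf₂ ?_
  rintro x ⟨l, ⟨hne, hhead, hlast, hchain⟩, rfl⟩
  cases l with
  | nil => exact absurd rfl hne
  | cons a l =>
    obtain rfl : a = w := by simpa using hhead
    have hpath : G.IsPathFrom v G.t (v :: a :: l) :=
      ⟨by simp, by simp, by simpa using hlast, List.isChain_cons_cons.2 ⟨h, hchain⟩⟩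
    calc G.dist v ≤ ENNReal.ofReal (G.pathCost (v :: a :: l)) := sInf_le ⟨_, hpath, rfl⟩
      _ ≤ ENNReal.ofReal (G.cost v a) + ENNReal.ofReal (G.pathCost (a :: l)) := by
        simpa [pathCost] using ENNReal.ofReal_add_le

/-- The perceived cost is at least the discounted distance to the target. -/
theorem mul_dist_le_zeta (G : TaskGraph V) {β : ℝ} (hβ : β ≤ 1) (v : V) :
    ENNReal.ofReal β * G.dist v ≤ G.zeta β v := by
  refine le_sInf ?_
  rintro x ⟨w, hw, rfl⟩
  calc ENNReal.ofReal β * G.dist v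
      ≤ ENNReal.ofReal β * (ENNReal.ofReal (G.cost v w) + G.dist w) := by
        gcongr
        exact G.dist_le_cost_add_dist hw
    _ ≤ ENNReal.ofReal (G.cost v w) + ENNReal.ofReal β * G.dist w := by
        rw [mul_add]
        gcongr
        exact mul_le_of_le_one_left' (ENNReal.ofReal_le_one.2 hβ)

/-- In a motivating graph the agent does not abandon at the source. -/
theorem Motivating.eq_target_or_zeta_le {G : TaskGraph V} {β r : ℝ} (h : G.Motivating β r) :
    G.s = G.t ∨ G.zeta β G.s ≤ ENNReal.ofReal (β * r) := by
  by_contra! hcon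
  refine hcon.1 ?_
  have hwalk : G.AgentWalk β r [G.s] := by
    refine ⟨rfl, List.isChain_singleton _, ?_⟩
    rintro v hv
    obtain rfl : G.s = v := by simpa using hv
    exact Or.inr hcon.2.not_ge
  simpa using h _ hwalk

end TaskGraph

/-- If some subgraph of `G` is motivating for reward `r ≥ 0`
and bias `β ∈ (0,1]`, then `r ≥ d_G(s)`, the minimum total edge cost of a
directed path from `s` to `t` in `G`. -/
theorem reward_ge_dist {V : Type} [Fintype V]
    (G : TaskGraph V) (β r : ℝ) (hβ0 : 0 < β) (hβ1 : β ≤ 1) (hr : 0 ≤ r)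
    (hmot : ∃ G' : TaskGraph V, G'.Subgraph G ∧ G'.Motivating β r) :
    G.dist G.s ≤ ENNReal.ofReal r := by
  obtain ⟨G', hsub, hmot⟩ := hmot
  rw [← hsub.1]
  refine (hsub.dist_le _).trans ?_
  rcases hmot.eq_target_or_zeta_le with hst | hz
  · rw [hst, G'.dist_target]
    exact zero_le
  · have h := (G'.mul_dist_le_zeta hβ1 G'.s).trans hz
    rw [ENNReal.ofReal_mul hβ0.le] at h
    exact (ENNReal.mul_le_mul_iff_right (ENNReal.ofReal_pos.2 hβ0).ne' ENNReal.ofReal_ne_top).1 h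
end
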